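/- Let M be a Hilbert C*-module over a C*-algebra A. Suppose p ∈ [0, 1), α, β, γ > 0, and f : M → M satisfies f(0) = 0 and ‖f(μx + y) − μf(x) − f(y) + f(⟨u, v⟩w) − ⟨f(u), v⟩w − ⟨u, f(v)⟩w − ⟨u, v⟩f(w)‖ ≤ α + β(‖x‖ᵖ + ‖y‖ᵖ + ‖u‖ᵖ + ‖v‖ᵖ + ‖w‖ᵖ) + γ·‖x‖^{p/2}·‖y‖^{p/2}·‖u‖^{p/2}·‖v‖^{p/2}·‖w‖^{p/2} for all μ ∈ 𝕋 = {z ∈ ℂ : |z| = 1} and all x, y, u, v, w ∈ M. Then there exists a unique derivation T₀ : M → M such that ‖f(x) − T₀(x)‖ ≤ (α + β·2^{1−p}·‖x‖ᵖ + γ·2^{−p}·‖x‖ᵖ)/(2^{1−p} − 1) for all x ∈ M. -/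

import Mathlib

/-- A ℂ-linear mapping `T : M → M` is a *derivation* on a Hilbert `A`-module `M`
(with `A`-valued inner product `ip`) if
`T (⟨x, y⟩ • z) = ⟨T x, y⟩ • z + ⟨x, T y⟩ • z + ⟨x, y⟩ • T z` for all `x, y, z`. -/
def IsHilbertModuleDerivation {A M : Type*} [Ring A] [AddCommGroup M]
    [Module ℂ M] [Module A M] (ip : M → M → A) (T : M → M) : Prop :=
  IsLinearMap ℂ T ∧
    ∀ x y z : M, T (ip x y • z) = ip (T x) y • z + ip x (T y) • z + ip x y • T z

open Filter Topology in
/-- A quantity whose multiples grow at most like `n ^ p` with `p < 1` is nonpositive. -/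
theorem nonpos_of_natCast_mul_le_add_mul_rpow {p : ℝ} (hp : p < 1) {a b c : ℝ}
    (h : ∀ n : ℕ, n * c ≤ a + b * (n : ℝ) ^ p) : c ≤ 0 := by
  have hdiv : Tendsto (fun n : ℕ => a / (n : ℝ)) atTop (𝓝 0) :=
    tendsto_const_nhds.div_atTop tendsto_natCast_atTop_atTop
  have hpow : Tendsto (fun n : ℕ => b * (n : ℝ) ^ (-(1 - p))) atTop (𝓝 0) := by
    simpa using ((tendsto_rpow_neg_atTop (sub_pos.2 hp)).comp
      tendsto_natCast_atTop_atTop).const_mul b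
  have hlim := hdiv.add hpow
  rw [add_zero] at hlim
  refine ge_of_tendsto hlim ?_
  filter_upwards [eventually_gt_atTop 0] with n hn
  have hn' : (0 : ℝ) < n := Nat.cast_pos.2 hn
  have hpn : (n : ℝ) ^ p = n * (n : ℝ) ^ (-(1 - p)) := by
    nth_rewrite 2 [← Real.rpow_one (n : ℝ)]
    rw [← Real.rpow_add hn']
    congr 1; ring
  have := h n
  rw [hpn] at this
  refine le_of_mul_le_mul_left (this.trans_eq ?_) hn'
  field_simp

/-- An additive map on complex vector spaces which commutes with unimodular scalars is linear. -/
theorem isLinearMap_of_map_unimodular_smul_add {E F : Type*} [AddCommGroup E] [Module ℂ E]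
    [AddCommGroup F] [Module ℂ F] {f : E → F} (hf0 : f 0 = 0)
    (hf : ∀ μ : ℂ, ‖μ‖ = 1 → ∀ x y, f (μ • x + y) = μ • f x + f y) : IsLinearMap ℂ f := by
  have hadd (x y : E) : f (x + y) = f x + f y := by simpa using hf 1 (by simp) x y
  have hunit (μ : ℂ) (hμ : ‖μ‖ = 1) (x : E) : f (μ • x) = μ • f x := by
    simpa [hf0] using hf μ hμ x 0
  have hcos (θ : ℝ) (x : E) :
      f ((2 * Complex.cos θ) • x) = (2 * Complex.cos θ) • f x := by
    rw [Complex.two_cos, add_smul, hadd, hunit _ (Complex.norm_exp_ofReal_mul_I θ),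
      hunit _ (by simpa using Complex.norm_exp_ofReal_mul_I (-θ)), add_smul]
  have hnat (n : ℕ) (x : E) : f (n • x) = n • f x :=
    map_nsmul (AddMonoidHom.mk' f hadd) n x
  have hreal (r : ℝ) (x : E) : f ((r : ℂ) • x) = (r : ℂ) • f x := by
    obtain ⟨n, hn⟩ := exists_nat_gt |r|
    have hn0 : (0 : ℝ) < n := (abs_nonneg r).trans_lt hn
    obtain ⟨h₁, h₂⟩ := abs_lt.1 hn
    have hr : (r : ℂ) = n * (2 * Complex.cos (Real.arccos (r / (2 * n)) : ℝ)) := by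
      rw [← Complex.ofReal_cos, Real.cos_arccos]
      · push_cast
        have : (n : ℂ) ≠ 0 := by exact_mod_cast hn0.ne'
        field_simp
      · rw [le_div_iff₀ (by positivity)]; linarith
      · rw [div_le_iff₀ (by positivity)]; linarith
    rw [hr, mul_smul (n : ℂ), mul_smul (n : ℂ), Nat.cast_smul_eq_nsmul, Nat.cast_smul_eq_nsmul,
      hnat, hcos]
  refine ⟨hadd, fun z x => ?_⟩
  rw [← Complex.norm_mul_exp_arg_mul_I z, mul_smul, hreal,
    hunit _ (Complex.norm_exp_ofReal_mul_I _), mul_smul]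

/-- Additive maps at distance `O(1 + ‖x‖ ^ p)` from each other, with `p < 1`, are equal. -/
theorem eq_of_additive_of_norm_sub_le_add_mul_rpow {E F : Type*} [NormedAddCommGroup E]
    [NormedSpace ℂ E] [NormedAddCommGroup F] [NormedSpace ℂ F] {S T : E →+ F} {p a b : ℝ}
    (hp : p < 1) (h : ∀ x, ‖S x - T x‖ ≤ a + b * ‖x‖ ^ p) : S = T := by
  ext x
  refine sub_eq_zero.1 (norm_le_zero_iff.1
    (nonpos_of_natCast_mul_le_add_mul_rpow (a := a) (b := b * ‖x‖ ^ p) hp fun n => ?_))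
  have := h (n • x)
  rw [map_nsmul, map_nsmul, ← nsmul_sub, RCLike.norm_nsmul ℂ, RCLike.norm_nsmul ℂ, nsmul_eq_mul,
    nsmul_eq_mul, Real.mul_rpow n.cast_nonneg (norm_nonneg x)] at this
  linarith

/-- An element of an inner product module with `⟨h, h⟩ • h = 0` vanishes. -/
theorem eq_zero_of_inner_self_smul_self_eq_zero {A M : Type*} [NormedRing A] [StarRing A]
    [CStarRing A] [AddCommGroup M] [Module A M] {ip : M → M → A}
    (ip_def : ∀ x : M, ip x x = 0 ↔ x = 0)
    (ip_smul : ∀ (a : A) (x y : M), ip (a • x) y = a * ip x y)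
    (ip_star : ∀ x y : M, star (ip x y) = ip y x) {h : M} (hh : ip h h • h = 0) : h = 0 := by
  rw [← ip_def, ← CStarRing.star_mul_self_eq_zero_iff, ip_star, ← ip_smul, hh]
  simpa using ip_smul 0 0 h

/-- A self-map of an inner product module over a `C*`-algebra is a derivation as soon as its
linearity defect and its derivation defect both grow sublinearly. -/
theorem isHilbertModuleDerivation_of_defect_le
    {A : Type*} [NormedRing A] [StarRing A] [CStarRing A] [NormedAlgebra ℂ A]
    {M : Type*} [NormedAddCommGroup M] [NormedSpace ℂ M] [Module A M] [IsScalarTower ℂ A M]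
    {ip : M → M → A} (ip_def : ∀ x : M, ip x x = 0 ↔ x = 0)
    (ip_add_smul : ∀ (l : ℂ) (x y z : M), ip (l • x + y) z = l • ip x z + ip y z)
    (ip_smul : ∀ (a : A) (x y : M), ip (a • x) y = a * ip x y)
    (ip_star : ∀ x y : M, star (ip x y) = ip y x)
    {p : ℝ} (hp1 : p < 1) {K β : ℝ} {f : M → M} (hf0 : f 0 = 0)
    (hlin : ∀ μ : ℂ, ‖μ‖ = 1 → ∀ x y : M,
      ‖f (μ • x + y) - μ • f x - f y‖ ≤ K + β * (‖x‖ ^ p + ‖y‖ ^ p))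
    (hder : ∀ u v w : M,
      ‖f (ip u v • w) - ip (f u) v • w - ip u (f v) • w - ip u v • f w‖ ≤
        K + β * (‖u‖ ^ p + ‖v‖ ^ p + ‖w‖ ^ p)) :
    IsHilbertModuleDerivation ip f := by
  have ip_sub (l : ℂ) (x y z v : M) :
      ip (x - l • y - z) v = ip x v - l • ip y v - ip z v := by
    have h₁ := ip_add_smul l y z v
    have h₂ := ip_add_smul 1 (x - l • y - z) (l • y + z) v
    rw [one_smul, one_smul, h₁, show x - l • y - z + (l • y + z) = x by abel] at h₂
    rw [h₂]; abel
  have norm_smul_nsmul_rpow (a : A) (w : M) (n : ℕ) :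
      ‖a • n • w‖ ^ p = (n : ℝ) ^ p * ‖a • w‖ ^ p := by
    rw [smul_comm, RCLike.norm_nsmul ℂ, nsmul_eq_mul,
      Real.mul_rpow n.cast_nonneg (norm_nonneg _)]
  have norm_nsmul_rpow (w : M) (n : ℕ) : ‖n • w‖ ^ p = (n : ℝ) ^ p * ‖w‖ ^ p := by
    simpa using norm_smul_nsmul_rpow 1 w n
  have hunit (μ : ℂ) (hμ : ‖μ‖ = 1) (x y : M) : f (μ • x + y) = μ • f x + f y := by
    set h := f (μ • x + y) - μ • f x - f y with hh
    suffices h = 0 by rwa [hh, sub_sub, sub_eq_zero] at this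
    refine eq_zero_of_inner_self_smul_self_eq_zero ip_def ip_smul ip_star
      (norm_le_zero_iff.1 (nonpos_of_natCast_mul_le_add_mul_rpow
        (a := 4 * K + β * (‖μ • x + y‖ ^ p + ‖x‖ ^ p + ‖y‖ ^ p + 3 * ‖h‖ ^ p))
        (b := β * (3 * ‖h‖ ^ p + ‖ip x h • h‖ ^ p + ‖ip y h • h‖ ^ p)) hp1 fun n => ?_))
    have e₁ := hder (μ • x + y) h (n • h)
    have e₂ := hder x h (n • h)
    have e₃ := hder y h (n • h)
    have e₄ := hlin μ hμ (ip x h • n • h) (ip y h • n • h)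
    rw [norm_nsmul_rpow] at e₁ e₂ e₃
    rw [norm_smul_nsmul_rpow, norm_smul_nsmul_rpow] at e₄
    rw [← one_mul ‖_ - ip (f x) h • _ - _ - _‖, ← hμ, ← norm_smul] at e₂
    rw [← nsmul_eq_mul, ← RCLike.norm_nsmul ℂ, ← smul_comm (ip h h) n h]
    have key : ip h h • n • h =
        (f (μ • (ip x h • n • h) + ip y h • n • h) - μ • f (ip x h • n • h)
          - f (ip y h • n • h))
        - (f (ip (μ • x + y) h • n • h) - ip (f (μ • x + y)) h • n • h
          - ip (μ • x + y) (f h) • n • h - ip (μ • x + y) h • f (n • h))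
        + μ • (f (ip x h • n • h) - ip (f x) h • n • h - ip x (f h) • n • h
          - ip x h • f (n • h))
        + (f (ip y h • n • h) - ip (f y) h • n • h - ip y (f h) • n • h
          - ip y h • f (n • h)) := by
      have : ip h h = ip (f (μ • x + y)) h - μ • ip (f x) h - ip (f y) h := by
        rw [← ip_sub]
      rw [this, ip_add_smul, ip_add_smul]
      simp only [add_smul, sub_smul, smul_sub, smul_assoc]
      abel
    rw [key]
    refine (norm_add_le_of_le (norm_add_le_of_le (norm_sub_le_of_le e₄ e₁) e₂) e₃).trans_eq ?_
    ring
  have hL : IsLinearMap ℂ f := isLinearMap_of_map_unimodular_smul_add hf0 hunit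
  refine ⟨hL, fun u v w => ?_⟩
  rw [← sub_eq_zero, ← sub_sub, ← sub_sub]
  refine norm_le_zero_iff.1 (nonpos_of_natCast_mul_le_add_mul_rpow
    (a := K + β * (‖u‖ ^ p + ‖v‖ ^ p)) (b := β * ‖w‖ ^ p) hp1 fun n => ?_)
  have hn (z : M) : f (n • z) = n • f z := map_nsmul (hL.mk' f) n z
  have := hder u v (n • w)
  simp only [hn, smul_comm _ n, ← nsmul_sub] at this
  rw [RCLike.norm_nsmul ℂ, nsmul_eq_mul, norm_nsmul_rpow] at this
  linarith

/-- **Rassias stability of derivations on Hilbert C*-modules (Corollary 2.4).**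
Let `M` be a Hilbert C*-module over a C*-algebra `A`, let `p ∈ [0, 1)`,
`α, β, γ > 0`, and suppose `f : M → M` satisfies `f 0 = 0` and
`‖f (μx + y) − μ f x − f y + f (⟨u,v⟩w) − ⟨f u, v⟩w − ⟨u, f v⟩w − ⟨u,v⟩ f w‖
  ≤ α + β (‖x‖ᵖ + ‖y‖ᵖ + ‖u‖ᵖ + ‖v‖ᵖ + ‖w‖ᵖ)
    + γ ‖x‖^(p/2) ‖y‖^(p/2) ‖u‖^(p/2) ‖v‖^(p/2) ‖w‖^(p/2)`
for all `μ ∈ 𝕋` and all `x, y, u, v, w ∈ M`.  Then there exists a unique derivation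
`T₀ : M → M` such that
`‖f x − T₀ x‖ ≤ (α + β 2^(1−p) ‖x‖ᵖ + γ 2^(−p) ‖x‖ᵖ) / (2^(1−p) − 1)` for all `x`. -/
theorem rassias_stability_of_derivations
    {A : Type*} [NormedRing A] [StarRing A] [CStarRing A] [NormedAlgebra ℂ A]
    [StarModule ℂ A] [CompleteSpace A] [PartialOrder A] [StarOrderedRing A]
    {M : Type*} [NormedAddCommGroup M] [NormedSpace ℂ M] [CompleteSpace M]
    [Module A M] [IsScalarTower ℂ A M]
    (ip : M → M → A)
    (ip_pos : ∀ x : M, 0 ≤ ip x x)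
    (ip_def : ∀ x : M, ip x x = 0 ↔ x = 0)
    (ip_add_smul : ∀ (l : ℂ) (x y z : M), ip (l • x + y) z = l • ip x z + ip y z)
    (ip_smul : ∀ (a : A) (x y : M), ip (a • x) y = a * ip x y)
    (ip_star : ∀ x y : M, star (ip x y) = ip y x)
    (ip_norm : ∀ x : M, ‖x‖ = Real.sqrt ‖ip x x‖)
    (p : ℝ) (hp0 : 0 ≤ p) (hp1 : p < 1)
    (α β γ : ℝ) (hα : 0 < α) (hβ : 0 < β) (hγ : 0 < γ)
    (f : M → M) (hf0 : f 0 = 0)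
    (hf : ∀ μ : ℂ, ‖μ‖ = 1 → ∀ x y u v w : M,
      ‖f (μ • x + y) - μ • f x - f y + f (ip u v • w)
          - ip (f u) v • w - ip u (f v) • w - ip u v • f w‖ ≤
        α + β * (‖x‖ ^ p + ‖y‖ ^ p + ‖u‖ ^ p + ‖v‖ ^ p + ‖w‖ ^ p)
          + γ * (‖x‖ ^ (p / 2) * ‖y‖ ^ (p / 2) * ‖u‖ ^ (p / 2) * ‖v‖ ^ (p / 2)
              * ‖w‖ ^ (p / 2))) :
    ∃! T₀ : M → M, IsHilbertModuleDerivation ip T₀ ∧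
      ∀ x : M, ‖f x - T₀ x‖ ≤
        (α + β * (2 : ℝ) ^ (1 - p) * ‖x‖ ^ p + γ * (2 : ℝ) ^ (-p) * ‖x‖ ^ p) /
          ((2 : ℝ) ^ (1 - p) - 1) := by
  have hz : (0 : ℝ) ^ p ≤ 1 := Real.zero_rpow_le_one p
  have hprod (q s : ℝ) (hs : q = 0 → s = 1) : (0 : ℝ) ^ q * s ≤ 1 := by
    rcases eq_or_ne q 0 with rfl | hq
    · simp [hs rfl]
    · simp [Real.zero_rpow hq]
  have hder : IsHilbertModuleDerivation ip f := by
    refine isHilbertModuleDerivation_of_defect_le (K := α + 3 * β + γ) (β := β)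
      ip_def ip_add_smul ip_smul ip_star hp1 hf0 (fun μ hμ x y => ?_) fun u v w => ?_
    · have ip_zero : ip 0 0 = 0 := (ip_def 0).2 rfl
      have hγ' := mul_le_mul_of_nonneg_left (hprod (p / 2)
        (‖x‖ ^ (p / 2) * ‖y‖ ^ (p / 2) * 0 ^ (p / 2) * 0 ^ (p / 2))
        fun h => by simp [h]) hγ.le
      have := hf μ hμ x y 0 0 0
      simp only [hf0, ip_zero, smul_zero, norm_zero, sub_zero, add_zero] at this
      nlinarith
    · have hγ' := mul_le_mul_of_nonneg_left (hprod (p / 2)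
        (0 ^ (p / 2) * ‖u‖ ^ (p / 2) * ‖v‖ ^ (p / 2) * ‖w‖ ^ (p / 2))
        fun h => by simp [h]) hγ.le
      have := hf 1 (by simp) 0 0 u v w
      simp only [hf0, smul_zero, norm_zero, sub_zero, add_zero, zero_add] at this
      nlinarith
  have hden : 0 < (2 : ℝ) ^ (1 - p) - 1 :=
    sub_pos.2 (Real.one_lt_rpow one_lt_two (sub_pos.2 hp1))
  refine ⟨f, ⟨hder, fun x => ?_⟩, fun T hT => ?_⟩
  · rw [sub_self, norm_zero]
    positivity
  · have hTf : (hT.1.1.mk' T).toAddMonoidHom = (hder.1.mk' f).toAddMonoidHom := by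
      refine eq_of_additive_of_norm_sub_le_add_mul_rpow
        (a := α / ((2 : ℝ) ^ (1 - p) - 1))
        (b := (β * (2 : ℝ) ^ (1 - p) + γ * (2 : ℝ) ^ (-p)) / ((2 : ℝ) ^ (1 - p) - 1))
        hp1 fun x => ?_
      rw [norm_sub_rev]
      refine (hT.2 x).trans_eq ?_
      ring
    exact funext (DFunLike.congr_fun hTf)
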